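/- For every horizon T ≥ 1 and every sequence of request patterns (x_t)_{t=1}^T, the regret of the FTPL coded caching policy with learning rates η_t = α√t satisfies R(T) ≤ (3·r_max·r_max^C·(|S|−1) / (2·√(2π)·α)) · ∑_{t=1}^T 1/√t + α·√T·G_max + (K²·max{M/N, 1−M/N} / (√(2π)·α)) · ∑_{t=1}^T 1/√t + α·G_max + r_max^C. Consequently the adversarial regret (the supremum of R(T) over all request sequences) is O(√T). -/

import Mathlib

open MeasureTheory ProbabilityTheory

noncomputable section

namespace CodedCaching

/-- The finite set of feasible cache configurations: binary vectors (entries in `{0,1}`)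
with at least `M` ones. -/
def configs (N M : ℕ) : Finset (Fin N → ℕ) :=
  (Fintype.piFinset fun _ : Fin N => Finset.range 2).filter fun s => M ≤ ∑ i, s i

/-- The finite set of request patterns: `ℕ`-valued vectors whose entries sum to `K`. -/
def requests (N K : ℕ) : Finset (Fin N → ℕ) :=
  (Fintype.piFinset fun _ : Fin N => Finset.range (K + 1)).filter fun x => ∑ i, x i = K

/-- The truncated request vector `y = min(x, 1_N)`, viewed as a real vector. -/
def trunc {N : ℕ} (x : Fin N → ℕ) : Fin N → ℝ := fun i => (min (x i) 1 : ℕ)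

/-- The coded part of the expected transmission rate:
`(⟨s,1⟩/M − 1)·(1 − (1 − M/⟨s,1⟩)^⟨x,s⟩)`. -/
def codedRate {N : ℕ} (M : ℕ) (s x : Fin N → ℕ) : ℝ :=
  ((∑ i, (s i : ℝ)) / M - 1) *
    (1 - (1 - (M : ℝ) / ∑ i, (s i : ℝ)) ^ (∑ i, x i * s i))

/-- The expected transmission rate `K(s,x) = ⟨1_N − s, y⟩ + codedRate`. -/
def rate {N : ℕ} (M : ℕ) (s x : Fin N → ℕ) : ℝ :=
  (∑ i, (1 - (s i : ℝ)) * trunc x i) + codedRate M s x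

/-- The common component value of the vector `f(x,s)`:
`(1/M)·(1 − (1 − M/⟨s,1⟩)^⟨x,s⟩)`. -/
def fcomp {N : ℕ} (M : ℕ) (x s : Fin N → ℕ) : ℝ :=
  (1 / M) * (1 - (1 - (M : ℝ) / ∑ i, (s i : ℝ)) ^ (∑ i, x i * s i))

/-- `r_max`: the maximum of the rate over feasible configurations and request patterns. -/
def rmax (N K M : ℕ) : ℝ :=
  sSup {r : ℝ | ∃ s ∈ configs N M, ∃ x ∈ requests N K, r = rate M s x}

/-- `r_max^C`: the maximum of the coded rate over feasible configurations and requests. -/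
def rmaxC (N K M : ℕ) : ℝ :=
  sSup {r : ℝ | ∃ s ∈ configs N M, ∃ x ∈ requests N K, r = codedRate M s x}

/-- The standard Gaussian measure `N(0, I_N)` on `ℝ^N`. -/
def gauss (N : ℕ) : Measure (Fin N → ℝ) :=
  Measure.pi fun _ => gaussianReal 0 1

/-- The Gaussian width constant `G_max = E_γ[max_{s ∈ S} ⟨s, γ⟩]`. -/
def gmax (N M : ℕ) : ℝ :=
  ∫ γ, sSup {r : ℝ | ∃ s ∈ configs N M, r = ∑ i, (s i : ℝ) * γ i} ∂gauss N

/-- The FTPL objective at time `t` with learning rate `η` and perturbation `γ`: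
`⟨ s − (M/N)·1_N , ∑_{i=1}^{t−1} f(x_i, s) − Y_t + η·γ ⟩` where `Y_t = ∑_{i=1}^{t−1} y_i`. -/
def obj {N : ℕ} (M : ℕ) (x : ℕ → Fin N → ℕ) (η : ℝ) (t : ℕ)
    (γ : Fin N → ℝ) (s : Fin N → ℕ) : ℝ :=
  ∑ j, ((s j : ℝ) - (M : ℝ) / N) *
    ((∑ i ∈ Finset.Ico 1 t, fcomp M (x i) s)
      - (∑ i ∈ Finset.Ico 1 t, trunc (x i) j) + η * γ j)

/-- The FTPL policy: a measurable selection `σ t γ` of a minimizer of the perturbed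
cumulative cost over the feasible configurations, for learning-rate schedule `η`. -/
def IsFTPL {N : ℕ} (M : ℕ) (η : ℕ → ℝ) (x : ℕ → Fin N → ℕ)
    (σ : ℕ → (Fin N → ℝ) → Fin N → ℕ) : Prop :=
  (∀ t, Measurable (σ t)) ∧ (∀ t γ, σ t γ ∈ configs N M) ∧
    ∀ t γ, ∀ s ∈ configs N M, obj M x (η t) t γ (σ t γ) ≤ obj M x (η t) t γ s

/-- The regret of a (randomly perturbed) policy `σ` on the request sequence `x`
over horizon `T`, with respect to the best static configuration in hindsight. -/
def regret {N : ℕ} (M : ℕ) (x : ℕ → Fin N → ℕ)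
    (σ : ℕ → (Fin N → ℝ) → Fin N → ℕ) (T : ℕ) : ℝ :=
  (∑ t ∈ Finset.Icc 1 T, ∫ γ, rate M (σ t γ) (x t) ∂gauss N)
    - sInf {r : ℝ | ∃ s ∈ configs N M, r = ∑ t ∈ Finset.Icc 1 T, rate M s (x t)}

/-- The expected number of cache-configuration switches of the policy `σ` up to time `T`. -/
def switchCount {N : ℕ} (σ : ℕ → (Fin N → ℝ) → Fin N → ℕ) (T : ℕ) : ℝ :=
  ∫ γ, (∑ t ∈ Finset.Icc 1 (T - 1), if σ (t + 1) γ = σ t γ then (0 : ℝ) else 1) ∂gauss N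


/-- The one-sided tent `v ↦ (1 - v / R)₊` on `[0, ∞)`, extended by zero to the left. -/
def halfTent (R v : ℝ) : ℝ := (Set.Icc 0 R).indicator (fun v => 1 - v / R) v

theorem halfTent_nonneg (R v : ℝ) : 0 ≤ halfTent R v := by
  refine Set.indicator_nonneg (fun v hv => ?_) v
  rcases (hv.1.trans hv.2).eq_or_lt with h | h
  · simp [← h]
  · rw [sub_nonneg, div_le_one h]
    exact hv.2

theorem halfTent_le_one (R v : ℝ) : halfTent R v ≤ 1 := by
  refine Set.indicator_apply_le' (fun hv => ?_) fun _ => zero_le_one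
  have : 0 ≤ v / R := div_nonneg hv.1 (hv.1.trans hv.2)
  linarith

theorem measurable_halfTent (R : ℝ) : Measurable (halfTent R) :=
  Measurable.indicator (by fun_prop) measurableSet_Icc

theorem integrable_halfTent (R : ℝ) : Integrable (halfTent R) :=
  (ContinuousOn.integrableOn_Icc (by fun_prop)).integrable_indicator measurableSet_Icc

theorem integral_halfTent {R : ℝ} (hR : 0 ≤ R) : ∫ v, halfTent R v = R / 2 := by
  unfold halfTent
  rw [integral_indicator measurableSet_Icc, integral_Icc_eq_integral_Ioc,
    ← intervalIntegral.integral_of_le hR,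
    intervalIntegral.integral_sub (by simp) (intervalIntegral.intervalIntegrable_id.div_const R),
    intervalIntegral.integral_div]
  rcases hR.eq_or_lt with h | h
  · simp [← h]
  · simp
    field_simp
    ring

theorem sub_div_le_halfTent {R v g : ℝ} (hv : 0 ≤ v) (hvg : v ≤ g) (hgR : g ≤ R) :
    1 - g / R ≤ halfTent R v := by
  rw [halfTent, Set.indicator_of_mem (show v ∈ Set.Icc 0 R from ⟨hv, hvg.trans hgR⟩)]
  have hR : 0 ≤ R := hv.trans (hvg.trans hgR)
  gcongr

theorem gaussianPDFReal_le (x : ℝ) :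
    gaussianPDFReal 0 1 x ≤ (Real.sqrt (2 * Real.pi))⁻¹ := by
  simp only [gaussianPDFReal, NNReal.coe_one, mul_one, sub_zero]
  refine mul_le_of_le_one_right (by positivity) (Real.exp_le_one_iff.2 ?_)
  have := sq_nonneg x
  linarith

/-- Smoothing an integrable nonnegative function by an affine image of a standard Gaussian. -/
theorem integral_comp_affine_gaussianReal_le {f : ℝ → ℝ} (hf : Integrable f) (h0 : ∀ v, 0 ≤ f v)
    {a : ℝ} (ha : a ≠ 0) (b : ℝ) :
    ∫ g, f (a * g + b) ∂gaussianReal 0 1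
      ≤ (Real.sqrt (2 * Real.pi))⁻¹ * (|a|⁻¹ * ∫ v, f v) := by
  have hint : Integrable fun g => f (a * g + b) :=
    (hf.comp_add_right b).comp_mul_left' ha
  have hval : ∫ g, f (a * g + b) = |a|⁻¹ * ∫ v, f v := by
    rw [Measure.integral_comp_mul_left (fun v => f (v + b)) a,
      integral_add_right_eq_self f b, abs_inv, smul_eq_mul]
  rw [integral_gaussianReal_eq_integral_smul one_ne_zero, ← hval, ← integral_const_mul]
  refine integral_mono_of_nonneg (ae_of_all _ fun g => ?_) (hint.const_mul _)
    (ae_of_all _ fun g => ?_)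
  · exact mul_nonneg (gaussianPDFReal_nonneg _ _ _) (h0 _)
  · exact mul_le_mul_of_nonneg_right (gaussianPDFReal_le g) (h0 _)

instance (N : ℕ) : IsProbabilityMeasure (gauss N) := by
  unfold gauss
  infer_instance

/-- If all one-dimensional sections of `f` in coordinate `j` have mean at most `c`, then so
does `f`. -/
theorem integral_gauss_le_of_section_le {N : ℕ} (j : Fin N) {f : (Fin N → ℝ) → ℝ} {c : ℝ}
    (hf : Measurable f) (h0 : ∀ γ, 0 ≤ f γ) (h1 : ∀ γ, f γ ≤ 1)
    (hc : ∀ γ, ∫ v, f (Function.update γ j v) ∂gaussianReal 0 1 ≤ c) :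
    ∫ γ, f γ ∂gauss N ≤ c := by
  have hc0 : 0 ≤ c := (integral_nonneg fun v => h0 _).trans (hc 0)
  rw [integral_eq_lintegral_of_nonneg_ae (ae_of_all _ h0) hf.aestronglyMeasurable]
  refine ENNReal.toReal_le_of_le_ofReal hc0 ?_
  have hmarg : ∫⁻ γ, ENNReal.ofReal (f γ) ∂gauss N ≤ ∫⁻ _, ENNReal.ofReal c ∂gauss N := by
    refine lintegral_le_of_lmarginal_le {j} hf.ennreal_ofReal measurable_const ?_
    rw [lmarginal_singleton, lmarginal_singleton]
    intro γ
    have hfu : Measurable fun v => f (Function.update γ j v) := hf.comp (measurable_update γ)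
    have hint : Integrable (fun v => f (Function.update γ j v)) (gaussianReal 0 1) :=
      Integrable.of_bound hfu.aestronglyMeasurable 1 (ae_of_all _ fun v => by
        rw [Real.norm_of_nonneg (h0 _)]
        exact h1 _)
    simp only [lintegral_const, measure_univ, mul_one]
    rw [← ofReal_integral_eq_lintegral_ofReal hint (ae_of_all _ fun v => h0 _)]
    exact ENNReal.ofReal_le_ofReal (hc γ)
  simpa using hmarg

/-- The linear perturbation `⟨s, γ⟩`. -/
def pert {N : ℕ} (γ : Fin N → ℝ) (s : Fin N → ℕ) : ℝ := ∑ i, (s i : ℝ) * γ i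

theorem integrable_eval_gauss {N : ℕ} (i : Fin N) :
    Integrable (fun γ : Fin N → ℝ => γ i) (gauss N) :=
  (measurePreserving_eval (fun _ : Fin N => gaussianReal 0 1) i).integrable_comp_of_integrable
    (memLp_one_iff_integrable.1 (memLp_id_gaussianReal 1))

theorem integral_eval_gauss {N : ℕ} (i : Fin N) : ∫ γ : Fin N → ℝ, γ i ∂gauss N = 0 := by
  have h := measurePreserving_eval (fun _ : Fin N => gaussianReal 0 1) i
  have := integral_map (μ := gauss N) (φ := Function.eval i) (f := fun v : ℝ => v)
    h.measurable.aemeasurable aestronglyMeasurable_id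
  rw [show Measure.map (Function.eval i) (gauss N) = gaussianReal 0 1 from h.map_eq,
    integral_id_gaussianReal] at this
  exact this.symm

theorem measurable_pert {N : ℕ} (s : Fin N → ℕ) : Measurable fun γ => pert γ s := by
  unfold pert
  fun_prop

theorem integrable_pert {N : ℕ} (s : Fin N → ℕ) : Integrable (fun γ => pert γ s) (gauss N) :=
  integrable_finsetSum _ fun i _ => (integrable_eval_gauss i).const_mul _

theorem integral_pert {N : ℕ} (s : Fin N → ℕ) : ∫ γ, pert γ s ∂gauss N = 0 := by
  unfold pert
  rw [integral_finsetSum _ fun i _ => (integrable_eval_gauss i).const_mul _]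
  simp [integral_const_mul, integral_eval_gauss]

theorem integral_neg_gauss {N : ℕ} (f : (Fin N → ℝ) → ℝ) :
    ∫ γ, f (-γ) ∂gauss N = ∫ γ, f γ ∂gauss N := by
  have h : MeasurePreserving (fun γ : Fin N → ℝ => -γ) (gauss N) (gauss N) :=
    measurePreserving_pi (fun _ : Fin N => gaussianReal 0 1) (fun _ => gaussianReal 0 1)
      fun _ => ⟨measurable_neg,
        (gaussianReal_map_neg (μ := 0) (v := 1)).trans (by rw [neg_zero])⟩
  exact h.integral_comp (MeasurableEquiv.neg _).measurableEmbedding f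

/-- The minimum of `f` over `S`, with value `0` when `S` is empty. -/
def minOver {ι : Type*} (S : Finset ι) (f : ι → ℝ) : ℝ :=
  if h : S.Nonempty then S.inf' h f else 0

theorem minOver_le {ι : Type*} {S : Finset ι} (f : ι → ℝ) {s : ι} (hs : s ∈ S) :
    minOver S f ≤ f s := by
  rw [minOver, dif_pos ⟨s, hs⟩]
  exact Finset.inf'_le f hs

theorem exists_minOver_eq {ι : Type*} {S : Finset ι} (hS : S.Nonempty) (f : ι → ℝ) :
    ∃ s ∈ S, minOver S f = f s := by
  rw [minOver, dif_pos hS]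
  exact Finset.exists_mem_eq_inf' hS f

theorem le_minOver {ι : Type*} {S : Finset ι} (hS : S.Nonempty) {f : ι → ℝ} {a : ℝ}
    (h : ∀ s ∈ S, a ≤ f s) : a ≤ minOver S f := by
  obtain ⟨s, hs, he⟩ := exists_minOver_eq hS f
  exact he ▸ h s hs

theorem measurable_minOver {Ω ι : Type*} [MeasurableSpace Ω] (S : Finset ι) {f : Ω → ι → ℝ}
    (hf : ∀ s, Measurable fun ω => f ω s) : Measurable fun ω => minOver S (f ω) := by
  unfold minOver
  split_ifs with h
  · have hinf : Measurable (S.inf' h fun s ω => f ω s) :=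
      Finset.inf'_induction h _ (fun _ h₁ _ h₂ => h₁.inf h₂) fun s _ => hf s
    convert hinf using 1
    ext ω
    simp [Finset.inf'_apply]
  · exact measurable_const

theorem integrable_minOver {Ω ι : Type*} [MeasurableSpace Ω] {μ : Measure Ω} (S : Finset ι)
    {f : Ω → ι → ℝ} (hf : ∀ s, Measurable fun ω => f ω s)
    (hi : ∀ s, Integrable (fun ω => f ω s) μ) : Integrable (fun ω => minOver S (f ω)) μ := by
  refine (integrable_finsetSum S fun s _ => (hi s).norm).mono'
    (measurable_minOver S hf).aestronglyMeasurable (ae_of_all _ fun ω => ?_)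
  rcases S.eq_empty_or_nonempty with rfl | hS
  · simp [minOver]
  · obtain ⟨s, hs, he⟩ := exists_minOver_eq hS (f ω)
    rw [he]
    exact Finset.single_le_sum (f := fun s => ‖f ω s‖) (fun _ _ => norm_nonneg _) hs

/-- The value of `η γ_j` above which the minimizer over `S` of `L + η ⟨·, γ⟩` has `j`-th
entry `0`; it does not depend on `γ_j`. -/
def threshold {N : ℕ} (S : Finset (Fin N → ℕ)) (L : (Fin N → ℕ) → ℝ) (η : ℝ) (j : Fin N)
    (γ : Fin N → ℝ) : ℝ :=
  minOver (S.filter fun s => s j = 0) (fun s => L s + η * pert (Function.update γ j 0) s)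
    - minOver (S.filter fun s => s j = 1) (fun s => L s + η * pert (Function.update γ j 0) s)

theorem threshold_update {N : ℕ} (S : Finset (Fin N → ℕ)) (L : (Fin N → ℕ) → ℝ) (η : ℝ)
    (j : Fin N) (γ : Fin N → ℝ) (v : ℝ) :
    threshold S L η j (Function.update γ j v) = threshold S L η j γ := by
  simp [threshold]

theorem measurable_threshold {N : ℕ} (S : Finset (Fin N → ℕ)) (L : (Fin N → ℕ) → ℝ) (η : ℝ)
    (j : Fin N) : Measurable (threshold S L η j) := by
  have h : ∀ s : Fin N → ℕ,
      Measurable fun γ : Fin N → ℝ => L s + η * pert (Function.update γ j 0) s := fun s =>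
    (((measurable_pert s).comp measurable_update_left).const_mul η).const_add (L s)
  exact (measurable_minOver _ h).sub (measurable_minOver _ h)

theorem pert_eq_update_add {N : ℕ} (γ : Fin N → ℝ) (j : Fin N) (s : Fin N → ℕ) :
    pert γ s = pert (Function.update γ j 0) s + s j * γ j := by
  unfold pert
  rw [← Finset.add_sum_erase _ _ (Finset.mem_univ j),
    ← Finset.add_sum_erase _ (fun i => (s i : ℝ) * Function.update γ j 0 i) (Finset.mem_univ j),
    Finset.sum_congr rfl fun i hi => by
      rw [← Function.update_of_ne (Finset.ne_of_mem_erase hi) (0 : ℝ) γ]]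
  simp
  ring

section Stability

variable {N : ℕ} {S : Finset (Fin N → ℕ)} {L : (Fin N → ℕ) → ℝ} {η : ℝ} {γ : Fin N → ℝ}
  {s₀ : Fin N → ℕ}

theorem threshold_gap_of_zero (hs₀ : s₀ ∈ S)
    (hmin : ∀ s ∈ S, L s₀ + η * pert γ s₀ ≤ L s + η * pert γ s) {s : Fin N → ℕ} (hs : s ∈ S)
    {j : Fin N} (h₀ : s₀ j = 0) (h₁ : s j = 1) :
    0 ≤ η * γ j - threshold S L η j γ ∧
      η * γ j - threshold S L η j γ
        ≤ (L s + η * pert γ s) - (L s₀ + η * pert γ s₀) := by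
  set B : (Fin N → ℕ) → ℝ := fun s => L s + η * pert (Function.update γ j 0) s with hB
  have hA : ∀ s, L s + η * pert γ s = B s + s j * (η * γ j) := fun s => by
    rw [hB, pert_eq_update_add γ j s]
    ring
  simp only [hA] at hmin ⊢
  have hm₀ : s₀ ∈ S.filter fun s => s j = 0 := by simp [hs₀, h₀]
  have hm₁ : s ∈ S.filter fun s => s j = 1 := by simp [hs, h₁]
  have e₀ : minOver (S.filter fun s => s j = 0) B = B s₀ :=
    le_antisymm (minOver_le B hm₀) (le_minOver ⟨_, hm₀⟩ fun s' hs' => by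
      rw [Finset.mem_filter] at hs'
      simpa [h₀, hs'.2] using hmin s' hs'.1)
  have e₁ := minOver_le B hm₁
  obtain ⟨s', hs', e'⟩ := exists_minOver_eq ⟨s, hm₁⟩ B
  rw [Finset.mem_filter] at hs'
  have e₂ := hmin s' hs'.1
  rw [show threshold S L η j γ = minOver (S.filter fun s => s j = 0) B
    - minOver (S.filter fun s => s j = 1) B from rfl, e₀]
  simp only [h₀, h₁, hs'.2, Nat.cast_zero, Nat.cast_one, zero_mul, one_mul, add_zero] at e₂ ⊢
  constructor <;> linarith

theorem threshold_gap_of_one (hs₀ : s₀ ∈ S)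
    (hmin : ∀ s ∈ S, L s₀ + η * pert γ s₀ ≤ L s + η * pert γ s) {s : Fin N → ℕ} (hs : s ∈ S)
    {j : Fin N} (h₀ : s₀ j = 1) (h₁ : s j = 0) :
    0 ≤ -(η * γ j - threshold S L η j γ) ∧
      -(η * γ j - threshold S L η j γ)
        ≤ (L s + η * pert γ s) - (L s₀ + η * pert γ s₀) := by
  set B : (Fin N → ℕ) → ℝ := fun s => L s + η * pert (Function.update γ j 0) s with hB
  have hA : ∀ s, L s + η * pert γ s = B s + s j * (η * γ j) := fun s => by
    rw [hB, pert_eq_update_add γ j s]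
    ring
  simp only [hA] at hmin ⊢
  have hm₀ : s₀ ∈ S.filter fun s => s j = 1 := by simp [hs₀, h₀]
  have hm₁ : s ∈ S.filter fun s => s j = 0 := by simp [hs, h₁]
  have e₀ : minOver (S.filter fun s => s j = 1) B = B s₀ :=
    le_antisymm (minOver_le B hm₀) (le_minOver ⟨_, hm₀⟩ fun s' hs' => by
      rw [Finset.mem_filter] at hs'
      simpa [h₀, hs'.2] using hmin s' hs'.1)
  have e₁ := minOver_le B hm₁
  obtain ⟨s', hs', e'⟩ := exists_minOver_eq ⟨s, hm₁⟩ B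
  rw [Finset.mem_filter] at hs'
  have e₂ := hmin s' hs'.1
  rw [show threshold S L η j γ = minOver (S.filter fun s => s j = 0) B
    - minOver (S.filter fun s => s j = 1) B from rfl, e₀]
  simp only [h₀, h₁, hs'.2, Nat.cast_zero, Nat.cast_one, zero_mul, one_mul, add_zero] at e₂ ⊢
  constructor <;> linarith

variable {ℓ κ : (Fin N → ℕ) → ℝ} {y : Fin N → ℝ} {C R : ℝ}

/-- Pathwise stability: the loss of a perturbed leader exceeds the increment of the perturbed
optimum by at most a sum of half-tents centred at the coordinatewise thresholds. -/
theorem leader_loss_le (hbin : ∀ s ∈ S, ∀ j, s j = 0 ∨ s j = 1) (hy : ∀ j, 0 ≤ y j)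
    (hκ0 : ∀ s ∈ S, 0 ≤ κ s) (hκC : ∀ s ∈ S, κ s ≤ C)
    (hℓ : ∀ s, ℓ s = (∑ j, (1 - (s j : ℝ)) * y j) + κ s)
    (hR : ∀ s ∈ S, ∀ s' ∈ S, ℓ s - ℓ s' ≤ R) (hs₀ : s₀ ∈ S)
    (hmin : ∀ s ∈ S, L s₀ + η * pert γ s₀ ≤ L s + η * pert γ s) :
    ℓ s₀ ≤ minOver S (fun s => L s + ℓ s + η * pert γ s)
      - minOver S (fun s => L s + η * pert γ s)
      + ∑ j, ((y j + C) * halfTent R (η * γ j - threshold S L η j γ)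
          + C * halfTent R (-(η * γ j - threshold S L η j γ))) := by
  have hC : 0 ≤ C := (hκ0 _ hs₀).trans (hκC _ hs₀)
  obtain ⟨s, hs, he⟩ := exists_minOver_eq ⟨s₀, hs₀⟩ fun s => L s + ℓ s + η * pert γ s
  have hle := minOver_le (fun s => L s + η * pert γ s) hs₀
  have hΔR := hR _ hs₀ _ hs
  have hg0 := sub_nonneg.2 (hmin s hs)
  rw [he]
  set g := (L s + η * pert γ s) - (L s₀ + η * pert γ s₀) with hg
  set p : Fin N → ℝ := fun j => halfTent R (η * γ j - threshold S L η j γ)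
  set q : Fin N → ℝ := fun j => halfTent R (-(η * γ j - threshold S L η j γ))
  have hterm : ∀ j, 0 ≤ (y j + C) * p j + C * q j := fun j =>
    add_nonneg (mul_nonneg (add_nonneg (hy j) hC) (halfTent_nonneg _ _))
      (mul_nonneg hC (halfTent_nonneg _ _))
  suffices hmain : ℓ s₀ - ℓ s - g ≤ ∑ j, ((y j + C) * p j + C * q j) by
    linarith
  rcases le_or_gt (ℓ s₀ - ℓ s) g with hΔg | hΔg
  · exact (sub_nonpos.2 hΔg).trans (Finset.sum_nonneg fun j _ => hterm j)
  have hgR : g ≤ R := hΔg.le.trans hΔR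
  have hRpos : 0 < R := hg0.trans_lt (hΔg.trans_le hΔR)
  have hw : 0 ≤ 1 - g / R := by
    rw [sub_nonneg, div_le_one hRpos]
    exact hgR
  have hne : s ≠ s₀ := by
    rintro rfl
    simp [hg] at hΔg
  obtain ⟨i, hi⟩ := Function.ne_iff.1 hne
  have hΔ : ℓ s₀ - ℓ s ≤ ∑ j, (((s j : ℝ) - s₀ j) * y j + if j = i then C else 0) := by
    rw [hℓ, hℓ, Finset.sum_add_distrib, Finset.sum_ite_eq' Finset.univ i,
      if_pos (Finset.mem_univ i)]
    have : ∑ j, ((s j : ℝ) - s₀ j) * y j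
        = (∑ j, (1 - (s₀ j : ℝ)) * y j) - ∑ j, (1 - (s j : ℝ)) * y j := by
      rw [← Finset.sum_sub_distrib]
      exact Finset.sum_congr rfl fun j _ => by ring
    linarith [hκ0 s hs, hκC s₀ hs₀]
  calc ℓ s₀ - ℓ s - g ≤ (ℓ s₀ - ℓ s) * (1 - g / R) := by
        have : (ℓ s₀ - ℓ s) * (g / R) ≤ g := by
          rw [mul_div_assoc', div_le_iff₀ hRpos, mul_comm]
          gcongr
        linarith
    _ ≤ (∑ j, (((s j : ℝ) - s₀ j) * y j + if j = i then C else 0)) * (1 - g / R) := by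
        gcongr
    _ ≤ ∑ j, ((y j + C) * p j + C * q j) := by
        rw [Finset.sum_mul]
        refine Finset.sum_le_sum fun j _ => ?_
        have hite : (if j = i then C else 0) ≤ C := by split_ifs <;> simp [hC]
        rcases hbin s₀ hs₀ j with h₀ | h₀ <;> rcases hbin s hs j with h₁ | h₁
        · have : j ≠ i := by
            rintro rfl
            exact hi (h₁.trans h₀.symm)
          simpa [h₀, h₁, this] using hterm j
        · obtain ⟨hv0, hvg⟩ := threshold_gap_of_zero hs₀ hmin hs h₀ h₁
          have hp : 1 - g / R ≤ p j := sub_div_le_halfTent hv0 hvg hgR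
          have hq : 0 ≤ C * q j := mul_nonneg hC (halfTent_nonneg _ _)
          have hyj := hy j
          simp only [h₀, h₁, Nat.cast_zero, Nat.cast_one, sub_zero, one_mul]
          calc (y j + if j = i then C else 0) * (1 - g / R) ≤ (y j + C) * p j := by
                gcongr
            _ ≤ _ := by linarith
        · obtain ⟨hv0, hvg⟩ := threshold_gap_of_one hs₀ hmin hs h₀ h₁
          have hq : 1 - g / R ≤ q j := sub_div_le_halfTent hv0 hvg hgR
          have hp : 0 ≤ (y j + C) * p j :=
            mul_nonneg (add_nonneg (hy j) hC) (halfTent_nonneg _ _)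
          simp only [h₀, h₁, Nat.cast_zero, Nat.cast_one, zero_sub]
          calc (-1 * y j + if j = i then C else 0) * (1 - g / R) ≤ C * q j := by
                gcongr
                linarith [hy j]
            _ ≤ _ := by linarith
        · have : j ≠ i := by
            rintro rfl
            exact hi (h₁.trans h₀.symm)
          simpa [h₀, h₁, this] using hterm j

theorem integral_halfTent_threshold_le (hR0 : 0 ≤ R) {a : ℝ} (hη : 0 < η) (ha : |a| = 1)
    (j : Fin N) :
    ∫ γ, halfTent R (a * (η * γ j - threshold S L η j γ)) ∂gauss N
      ≤ R / (2 * Real.sqrt (2 * Real.pi) * η) := by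
  refine integral_gauss_le_of_section_le j ?_ (fun _ => halfTent_nonneg _ _)
    (fun _ => halfTent_le_one _ _) fun γ => ?_
  · exact (measurable_halfTent R).comp
      ((((measurable_pi_apply j).const_mul η).sub (measurable_threshold S L η j)).const_mul a)
  · have ha0 : a ≠ 0 := by
      rintro rfl
      simp at ha
    have h := integral_comp_affine_gaussianReal_le (integrable_halfTent R) (halfTent_nonneg R)
      (mul_ne_zero ha0 hη.ne') (-(a * threshold S L η j γ))
    rw [integral_halfTent hR0, abs_mul, ha, one_mul, abs_of_pos hη] at h
    calc _ = ∫ v, halfTent R (a * η * v + -(a * threshold S L η j γ)) ∂gaussianReal 0 1 := by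
          congr 1
          ext v
          rw [threshold_update, Function.update_self]
          ring_nf
      _ ≤ _ := h
      _ = _ := by
          field_simp

theorem integrable_halfTent_threshold (a : ℝ) (j : Fin N) :
    Integrable (fun γ => halfTent R (a * (η * γ j - threshold S L η j γ))) (gauss N) := by
  refine Integrable.of_bound (Measurable.aestronglyMeasurable ?_) 1 (ae_of_all _ fun γ => ?_)
  · exact (measurable_halfTent R).comp
      ((((measurable_pi_apply j).const_mul η).sub (measurable_threshold S L η j)).const_mul a)
  · rw [Real.norm_of_nonneg (halfTent_nonneg _ _)]
    exact halfTent_le_one _ _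

theorem integrable_minOver_pert (S : Finset (Fin N → ℕ)) (L : (Fin N → ℕ) → ℝ) (η : ℝ) :
    Integrable (fun γ => minOver S fun s => L s + η * pert γ s) (gauss N) :=
  integrable_minOver S (fun s => ((measurable_pert s).const_mul η).const_add (L s))
    fun s => (integrable_const (L s)).add ((integrable_pert s).const_mul η)

/-- Averaged stability of a perturbed leader. -/
theorem integral_leader_loss_le (hbin : ∀ s ∈ S, ∀ j, s j = 0 ∨ s j = 1) (hy : ∀ j, 0 ≤ y j)
    (hκ0 : ∀ s ∈ S, 0 ≤ κ s) (hκC : ∀ s ∈ S, κ s ≤ C)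
    (hℓ : ∀ s, ℓ s = (∑ j, (1 - (s j : ℝ)) * y j) + κ s)
    (hR : ∀ s ∈ S, ∀ s' ∈ S, ℓ s - ℓ s' ≤ R) (hη : 0 < η) {σ : (Fin N → ℝ) → Fin N → ℕ}
    (hσ : Measurable σ) (hσS : ∀ γ, σ γ ∈ S)
    (hmin : ∀ γ, ∀ s ∈ S, L (σ γ) + η * pert γ (σ γ) ≤ L s + η * pert γ s) :
    ∫ γ, ℓ (σ γ) ∂gauss N ≤ ∫ γ, minOver S (fun s => L s + ℓ s + η * pert γ s) ∂gauss N
      - ∫ γ, minOver S (fun s => L s + η * pert γ s) ∂gauss N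
      + ((∑ j, y j) + 2 * N * C) * R / (2 * Real.sqrt (2 * Real.pi) * η) := by
  have hR0 : 0 ≤ R := by simpa using hR _ (hσS 0) _ (hσS 0)
  have hC : 0 ≤ C := (hκ0 _ (hσS 0)).trans (hκC _ (hσS 0))
  have hiℓ : Integrable (fun γ => ℓ (σ γ)) (gauss N) := by
    refine Integrable.of_bound
      ((measurable_of_countable ℓ).comp hσ).aestronglyMeasurable (∑ s ∈ S, ‖ℓ s‖)
      (ae_of_all _ fun γ => ?_)
    exact Finset.single_le_sum (f := fun s => ‖ℓ s‖) (fun _ _ => norm_nonneg _) (hσS γ)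
  have hip := fun j => integrable_halfTent_threshold (S := S) (L := L) (η := η) (R := R) 1 j
  have hiq := fun j => integrable_halfTent_threshold (S := S) (L := L) (η := η) (R := R) (-1) j
  have hp := fun j => integral_halfTent_threshold_le (S := S) (L := L) hR0 hη (a := 1) (by simp) j
  have hq := fun j => integral_halfTent_threshold_le (S := S) (L := L) hR0 hη (a := -1) (by simp) j
  simp only [one_mul, neg_one_mul] at hip hiq hp hq
  have hi₁ := integrable_minOver_pert S (fun s => L s + ℓ s) η
  have hi₀ := integrable_minOver_pert S L η
  have hij := fun j => ((hip j).const_mul (y j + C)).add ((hiq j).const_mul C)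
  have his := integrable_finsetSum Finset.univ fun j _ => hij j
  have h := integral_mono hiℓ ((hi₁.sub hi₀).add his)
    fun γ => leader_loss_le hbin hy hκ0 hκC hℓ hR (hσS γ) (hmin γ)
  refine h.trans ?_
  rw [integral_add' (hi₁.sub hi₀) his, integral_sub' hi₁ hi₀,
    integral_finsetSum _ fun j _ => hij j]
  gcongr
  calc _ ≤ ∑ j, ((y j + C) * (R / (2 * Real.sqrt (2 * Real.pi) * η))
          + C * (R / (2 * Real.sqrt (2 * Real.pi) * η))) := by
        refine Finset.sum_le_sum fun j _ => ?_
        rw [integral_add' ((hip j).const_mul _) ((hiq j).const_mul _), integral_const_mul,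
          integral_const_mul]
        exact add_le_add (mul_le_mul_of_nonneg_left (hp j) (add_nonneg (hy j) hC))
          (mul_le_mul_of_nonneg_left (hq j) hC)
    _ = _ := by
        simp only [add_mul, Finset.sum_add_distrib, ← Finset.sum_mul]
        simp
        ring

end Stability

theorem integral_minOver_pert_anti {N : ℕ} {S : Finset (Fin N → ℕ)} (hS : S.Nonempty)
    (L : (Fin N → ℕ) → ℝ) {η η' : ℝ} (h : η ≤ η') :
    ∫ γ, minOver S (fun s => L s + η * pert γ s) ∂gauss N
      ≤ ∫ γ, minOver S (fun s => L s + η' * pert γ s) ∂gauss N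
        - (η' - η) * ∫ γ, minOver S (pert γ) ∂gauss N := by
  have hw : Integrable (fun γ => minOver S (pert γ)) (gauss N) :=
    integrable_minOver S measurable_pert integrable_pert
  rw [← integral_const_mul, ← integral_sub (integrable_minOver_pert S L η') (hw.const_mul _)]
  refine integral_mono (integrable_minOver_pert S L η)
    ((integrable_minOver_pert S L η').sub (hw.const_mul _)) fun γ => ?_
  obtain ⟨s, hs, he⟩ := exists_minOver_eq hS fun s => L s + η' * pert γ s
  have h₁ := minOver_le (fun s => L s + η * pert γ s) hs
  have h₂ := mul_le_mul_of_nonneg_left (minOver_le (pert γ) hs) (sub_nonneg.2 h)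
  simp only [he] at h₁ ⊢
  linarith

theorem integral_minOver_pert_le {N : ℕ} {S : Finset (Fin N → ℕ)} (L : (Fin N → ℕ) → ℝ) (η : ℝ)
    {s : Fin N → ℕ} (hs : s ∈ S) :
    ∫ γ, minOver S (fun s => L s + η * pert γ s) ∂gauss N ≤ L s := by
  calc _ ≤ ∫ γ, (L s + η * pert γ s) ∂gauss N :=
        integral_mono (integrable_minOver_pert S L η)
          ((integrable_const _).add ((integrable_pert s).const_mul η))
          fun γ => minOver_le (fun s => L s + η * pert γ s) hs
    _ = L s := by
        rw [integral_add (integrable_const _) ((integrable_pert s).const_mul η),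
          integral_const_mul, integral_pert]
        simp

/-- Telescoping of the perturbed optima under a nondecreasing perturbation schedule. -/
theorem sum_loss_le {N : ℕ} {S : Finset (Fin N → ℕ)} (hS : S.Nonempty)
    {loss : ℕ → (Fin N → ℕ) → ℝ} {η e D : ℕ → ℝ} (hη : Monotone η) (hη0 : η 0 = 0)
    (h : ∀ t, e (t + 1) ≤
      ∫ γ, minOver S (fun s => ∑ i ∈ Finset.Icc 1 t, loss i s + loss (t + 1) s
          + η (t + 1) * pert γ s) ∂gauss N
        - ∫ γ, minOver S (fun s => ∑ i ∈ Finset.Icc 1 t, loss i s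
          + η (t + 1) * pert γ s) ∂gauss N + D (t + 1)) (T : ℕ) :
    ∑ t ∈ Finset.Icc 1 T, e t ≤
      ∫ γ, minOver S (fun s => ∑ i ∈ Finset.Icc 1 T, loss i s + η T * pert γ s) ∂gauss N
        - η T * ∫ γ, minOver S (pert γ) ∂gauss N + ∑ t ∈ Finset.Icc 1 T, D t := by
  induction T with
  | zero =>
    simpa [hη0] using le_minOver hS fun _ _ => le_refl (0 : ℝ)
  | succ T ih =>
    have h₁ := h T
    have h₂ := integral_minOver_pert_anti hS (fun s => ∑ i ∈ Finset.Icc 1 T, loss i s)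
      (hη T.le_succ)
    simp only [Finset.sum_Icc_succ_top (Nat.le_add_left 1 T)]
    simp only [Nat.succ_eq_add_one] at h₂
    linarith

section Model

variable {N K M : ℕ} {s x : Fin N → ℕ}

theorem eq_zero_or_one_of_mem_configs (hs : s ∈ configs N M) (j : Fin N) :
    s j = 0 ∨ s j = 1 := by
  have := Fintype.mem_piFinset.1 (Finset.mem_filter.1 hs).1 j
  rw [Finset.mem_range] at this
  omega

theorem le_sum_of_mem_configs (hs : s ∈ configs N M) : (M : ℝ) ≤ ∑ i, (s i : ℝ) := by
  exact_mod_cast (Finset.mem_filter.1 hs).2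

theorem one_mem_configs (hMN : M ≤ N) : (fun _ => 1) ∈ configs N M := by
  simp [configs, hMN]

theorem update_one_mem_configs (hMN : M < N) (j : Fin N) :
    Function.update (fun _ => 1) j 0 ∈ configs N M := by
  refine Finset.mem_filter.2 ⟨Fintype.mem_piFinset.2 fun i => ?_, ?_⟩
  · rcases eq_or_ne i j with rfl | h <;> simp [*]
  · rw [Finset.sum_update_of_mem (Finset.mem_univ j)]
    simp [Finset.card_sdiff]
    omega

theorem lt_card_configs (hMN : M < N) : N < (configs N M).card := by
  have hinj : Function.Injective fun j : Fin N => Function.update (fun _ => 1) j 0 := by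
    intro i j hij
    by_contra hne
    simpa [Function.update_of_ne hne] using congrFun hij i
  have hnot : (fun _ : Fin N => 1) ∉
      Finset.univ.image fun j : Fin N => Function.update (fun _ => 1) j 0 := by
    intro h
    obtain ⟨j, -, hj⟩ := Finset.mem_image.1 h
    simpa using congrFun hj j
  have hsub : insert (fun _ => 1)
      (Finset.univ.image fun j : Fin N => Function.update (fun _ => 1) j 0) ⊆ configs N M := by
    intro s hs
    rcases Finset.mem_insert.1 hs with rfl | hs
    · exact one_mem_configs hMN.le
    · obtain ⟨j, -, rfl⟩ := Finset.mem_image.1 hs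
      exact update_one_mem_configs hMN j
  have := Finset.card_le_card hsub
  rw [Finset.card_insert_of_notMem hnot, Finset.card_image_of_injective _ hinj] at this
  simpa using this

theorem single_mem_requests (j : Fin N) : Pi.single j K ∈ requests N K := by
  refine Finset.mem_filter.2 ⟨Fintype.mem_piFinset.2 fun i => ?_, by simp⟩
  rcases eq_or_ne i j with rfl | h <;> simp [*]

theorem trunc_nonneg (x : Fin N → ℕ) (j : Fin N) : 0 ≤ trunc x j := Nat.cast_nonneg _

theorem sum_trunc_le_card (x : Fin N → ℕ) : ∑ j, trunc x j ≤ N := by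
  calc ∑ j, trunc x j ≤ ∑ _j : Fin N, (1 : ℝ) := Finset.sum_le_sum fun j _ => by
        unfold trunc
        exact_mod_cast min_le_right _ _
    _ = N := by simp

theorem sum_trunc_le_of_mem_requests (hx : x ∈ requests N K) : ∑ j, trunc x j ≤ K := by
  calc ∑ j, trunc x j ≤ ∑ j, (x j : ℝ) := Finset.sum_le_sum fun j _ => by
        unfold trunc
        exact_mod_cast min_le_left _ _
    _ = K := by exact_mod_cast (Finset.mem_filter.1 hx).2

theorem codedRate_nonneg (hM : 0 < M) (hs : s ∈ configs N M) (x : Fin N → ℕ) :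
    0 ≤ codedRate M s x := by
  have h := le_sum_of_mem_configs hs
  have hM' : (0 : ℝ) < M := by exact_mod_cast hM
  have h₁ : (M : ℝ) / ∑ i, (s i : ℝ) ≤ 1 := (div_le_one (hM'.trans_le h)).2 h
  have h₂ : 0 ≤ (M : ℝ) / ∑ i, (s i : ℝ) := div_nonneg hM'.le (hM'.le.trans h)
  refine mul_nonneg (sub_nonneg.2 ((one_le_div hM').2 h)) (sub_nonneg.2 ?_)
  exact pow_le_one₀ (by linarith) (by linarith)

theorem uncoded_nonneg (hs : s ∈ configs N M) (x : Fin N → ℕ) (j : Fin N) :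
    0 ≤ (1 - (s j : ℝ)) * trunc x j := by
  refine mul_nonneg ?_ (trunc_nonneg x j)
  rcases eq_zero_or_one_of_mem_configs hs j with h | h <;> simp [h]

theorem rate_nonneg (hM : 0 < M) (hs : s ∈ configs N M) (x : Fin N → ℕ) : 0 ≤ rate M s x :=
  add_nonneg (Finset.sum_nonneg fun j _ => uncoded_nonneg hs x j) (codedRate_nonneg hM hs x)

theorem le_sSup_configs_requests (f : (Fin N → ℕ) → (Fin N → ℕ) → ℝ) (hs : s ∈ configs N M)
    (hx : x ∈ requests N K) :
    f s x ≤ sSup {r : ℝ | ∃ s ∈ configs N M, ∃ x ∈ requests N K, r = f s x} := by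
  refine le_csSup (Set.Finite.bddAbove ?_) ⟨s, hs, x, hx, rfl⟩
  refine (((configs N M) ×ˢ (requests N K)).image fun p => f p.1 p.2).finite_toSet.subset ?_
  rintro r ⟨s, hs, x, hx, rfl⟩
  exact Finset.mem_image.2 ⟨(s, x), Finset.mem_product.2 ⟨hs, hx⟩, rfl⟩

theorem rate_le_rmax (hs : s ∈ configs N M) (hx : x ∈ requests N K) : rate M s x ≤ rmax N K M :=
  le_sSup_configs_requests (rate M) hs hx

theorem codedRate_le_rmaxC (hs : s ∈ configs N M) (hx : x ∈ requests N K) :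
    codedRate M s x ≤ rmaxC N K M :=
  le_sSup_configs_requests (codedRate M) hs hx

theorem rate_sub_rate_le (hM : 0 < M) {s' : Fin N → ℕ} (hs : s ∈ configs N M)
    (hs' : s' ∈ configs N M) (hx : x ∈ requests N K) :
    rate M s x - rate M s' x ≤ min (rmax N K M) (∑ j, trunc x j + rmaxC N K M) := by
  have h₀ := rate_nonneg hM hs' x
  refine le_min (by linarith [rate_le_rmax hs hx]) ?_
  have : ∑ j, (1 - (s j : ℝ)) * trunc x j ≤ ∑ j, trunc x j := Finset.sum_le_sum fun j _ =>
    mul_le_of_le_one_left (trunc_nonneg x j) (by simp)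
  have := codedRate_le_rmaxC hs hx
  rw [rate]
  linarith

theorem one_le_rmax (hK : 0 < K) (hM : 0 < M) (hMN : M < N) : 1 ≤ rmax N K M := by
  let j : Fin N := ⟨0, by omega⟩
  have hs := update_one_mem_configs hMN j
  refine le_trans ?_ (rate_le_rmax hs (single_mem_requests (K := K) j))
  refine le_add_of_le_of_nonneg ?_ (codedRate_nonneg hM hs _)
  refine le_trans ?_ (Finset.single_le_sum (fun i _ => uncoded_nonneg hs _ i) (Finset.mem_univ j))
  simp [trunc, Nat.succ_le_of_lt hK]

theorem rmaxC_nonneg (hN : 0 < N) (hM : 0 < M) (hMN : M ≤ N) : 0 ≤ rmaxC N K M :=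
  (codedRate_nonneg hM (one_mem_configs hMN) _).trans
    (codedRate_le_rmaxC (one_mem_configs hMN) (single_mem_requests (K := K) ⟨0, hN⟩))

theorem rmax_nonneg (hN : 0 < N) (hM : 0 < M) (hMN : M ≤ N) : 0 ≤ rmax N K M :=
  (rate_nonneg hM (one_mem_configs hMN) _).trans
    (rate_le_rmax (one_mem_configs hMN) (single_mem_requests (K := K) ⟨0, hN⟩))

theorem rmaxC_self (hN : 0 < N) : rmaxC N K N = 0 := by
  refine le_antisymm (csSup_le ⟨_, _, one_mem_configs le_rfl, _,
    single_mem_requests (K := K) ⟨0, hN⟩, rfl⟩ ?_) (rmaxC_nonneg hN hN le_rfl)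
  rintro r ⟨s, hs, x, -, rfl⟩
  have h₁ := le_sum_of_mem_configs hs
  have h₂ : ∑ i, (s i : ℝ) ≤ N := by
    calc ∑ i, (s i : ℝ) ≤ ∑ _i : Fin N, (1 : ℝ) := Finset.sum_le_sum fun i _ => by
          rcases eq_zero_or_one_of_mem_configs hs i with h | h <;> simp [h]
      _ = N := by simp
  have hN' : (N : ℝ) ≠ 0 := by positivity
  simp [codedRate, le_antisymm h₂ h₁, hN']

theorem obj_eq (hN : 0 < N) (hM : 0 < M) (x : ℕ → Fin N → ℕ) (η : ℝ) (t : ℕ) (γ : Fin N → ℝ)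
    (s : Fin N → ℕ) :
    obj M x η t γ s = ∑ i ∈ Finset.Ico 1 t, rate M s (x i) + η * pert γ s
      - (∑ i ∈ Finset.Ico 1 t, (1 - (M : ℝ) / N) * ∑ j, trunc (x i) j
          + η * ((M : ℝ) / N * ∑ j, γ j)) := by
  have hN' : (N : ℝ) ≠ 0 := by positivity
  have hM' : (M : ℝ) ≠ 0 := by positivity
  have hrate : ∀ i, rate M s (x i) = ∑ j, (1 - (s j : ℝ)) * trunc (x i) j
      + (∑ j, ((s j : ℝ) - (M : ℝ) / N)) * fcomp M (x i) s := fun i => by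
    rw [rate, codedRate, fcomp, Finset.sum_sub_distrib]
    simp only [Finset.sum_const, Finset.card_univ, Fintype.card_fin, nsmul_eq_mul,
      mul_div_cancel₀ _ hN']
    field_simp
  simp only [obj, pert, hrate, mul_add, mul_sub, Finset.sum_add_distrib, Finset.sum_sub_distrib,
    Finset.mul_sum, Finset.sum_mul, sub_mul, one_mul]
  rw [Finset.sum_comm (s := Finset.univ) (t := Finset.Ico 1 t),
    Finset.sum_comm (s := Finset.univ) (t := Finset.Ico 1 t),
    Finset.sum_comm (s := Finset.univ) (t := Finset.Ico 1 t),
    Finset.sum_comm (s := Finset.univ) (t := Finset.Ico 1 t)]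
  simp only [mul_left_comm η]
  ring

theorem gmax_eq (hMN : M ≤ N) : gmax N M = -∫ γ, minOver (configs N M) (pert γ) ∂gauss N := by
  rw [← integral_neg, ← integral_neg_gauss, gmax]
  congr 1
  ext γ
  have hne : ∀ s, pert (-γ) s = -pert γ s := fun s => by simp [pert]
  obtain ⟨s, hs, he⟩ := exists_minOver_eq ⟨_, one_mem_configs hMN⟩ (pert (-γ))
  refine IsGreatest.csSup_eq ⟨⟨s, hs, ?_⟩, ?_⟩
  · rw [he, hne, neg_neg, pert]
  · rintro r ⟨s', hs', rfl⟩
    have := minOver_le (pert (-γ)) hs'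
    rw [hne] at this
    change pert γ s' ≤ _
    linarith

theorem gmax_nonneg (hMN : M ≤ N) : 0 ≤ gmax N M := by
  rw [gmax_eq hMN, neg_nonneg]
  simpa using integral_minOver_pert_le (S := configs N M) 0 1 (one_mem_configs hMN)

theorem stability_constant_le (hN : 0 < N) (hK : 0 < K) (hM : 0 < M) (hMN : M ≤ N) {n R : ℝ}
    (hn0 : 0 ≤ n) (hnN : n ≤ N) (hnK : n ≤ K) (hR : R = min (rmax N K M) (n + rmaxC N K M)) :
    (n + 2 * N * rmaxC N K M) * R ≤
      3 * rmax N K M * rmaxC N K M * (((configs N M).card : ℝ) - 1)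
        + 2 * ((K : ℝ) ^ 2 * max ((M : ℝ) / N) (1 - (M : ℝ) / N)) := by
  have hC := rmaxC_nonneg (K := K) hN hM hMN
  have hr := rmax_nonneg (K := K) hN hM hMN
  have hR₁ : R ≤ rmax N K M := hR ▸ min_le_left _ _
  have hR₂ : R ≤ n + rmaxC N K M := hR ▸ min_le_right _ _
  have hmax : 1 ≤ 2 * max ((M : ℝ) / N) (1 - (M : ℝ) / N) := by
    linarith [le_max_left ((M : ℝ) / N) (1 - (M : ℝ) / N),
      le_max_right ((M : ℝ) / N) (1 - (M : ℝ) / N)]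
  have hcoded : N * rmaxC N K M ≤ rmaxC N K M * (((configs N M).card : ℝ) - 1) ∧
      N * rmaxC N K M ≤ rmax N K M * rmaxC N K M * (((configs N M).card : ℝ) - 1) := by
    rcases hMN.eq_or_lt with rfl | hlt
    · simp [rmaxC_self hN]
    · have hcard : (N : ℝ) ≤ ((configs N M).card : ℝ) - 1 := by
        rw [le_sub_iff_add_le]
        exact_mod_cast lt_card_configs hlt
      have h₁ : N * rmaxC N K M ≤ rmaxC N K M * (((configs N M).card : ℝ) - 1) := by
        rw [mul_comm]
        gcongr
      refine ⟨h₁, h₁.trans ?_⟩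
      rw [mul_assoc]
      exact le_mul_of_one_le_left (h₁.trans' (by positivity)) (one_le_rmax hK hM hlt)
  have h₁ : n * R ≤ K ^ 2 + N * rmaxC N K M := by
    calc n * R ≤ n * (n + rmaxC N K M) := by gcongr
      _ = n ^ 2 + n * rmaxC N K M := by ring
      _ ≤ _ := by gcongr
  have h₂ : N * rmaxC N K M * R
      ≤ rmax N K M * rmaxC N K M * (((configs N M).card : ℝ) - 1) := by
    calc N * rmaxC N K M * R ≤ N * rmaxC N K M * rmax N K M := by gcongr
      _ ≤ rmaxC N K M * (((configs N M).card : ℝ) - 1) * rmax N K M :=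
        mul_le_mul_of_nonneg_right hcoded.1 hr
      _ = _ := by ring
  have h₃ : (K : ℝ) ^ 2 * 1 ≤ K ^ 2 * (2 * max ((M : ℝ) / N) (1 - (M : ℝ) / N)) := by gcongr
  linarith [hcoded.2]

theorem regret_le (hN : 0 < N) (hK : 0 < K) (hM : 0 < M) (hMN : M ≤ N) {α : ℝ} (hα : 0 < α)
    {x : ℕ → Fin N → ℕ} (hx : ∀ t, x t ∈ requests N K) {σ : ℕ → (Fin N → ℝ) → Fin N → ℕ}
    (hσ : IsFTPL M (fun t => α * Real.sqrt t) x σ) (T : ℕ) :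
    regret M x σ T ≤
      3 * rmax N K M * rmaxC N K M * (((configs N M).card : ℝ) - 1)
          / (2 * Real.sqrt (2 * Real.pi) * α) * (∑ t ∈ Finset.Icc 1 T, 1 / Real.sqrt t)
        + α * Real.sqrt T * gmax N M
        + (K : ℝ) ^ 2 * max ((M : ℝ) / N) (1 - (M : ℝ) / N)
          / (Real.sqrt (2 * Real.pi) * α) * (∑ t ∈ Finset.Icc 1 T, 1 / Real.sqrt t) := by
  obtain ⟨hmeas, hmem, hmin⟩ := hσ
  set A := 3 * rmax N K M * rmaxC N K M * (((configs N M).card : ℝ) - 1)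
  set B := (K : ℝ) ^ 2 * max ((M : ℝ) / N) (1 - (M : ℝ) / N)
  have hstep : ∀ t : ℕ, ∫ γ, rate M (σ (t + 1) γ) (x (t + 1)) ∂gauss N ≤
      ∫ γ, minOver (configs N M) (fun s => ∑ i ∈ Finset.Icc 1 t, rate M s (x i)
          + rate M s (x (t + 1)) + α * Real.sqrt ((t + 1 : ℕ) : ℝ) * pert γ s) ∂gauss N
        - ∫ γ, minOver (configs N M) (fun s => ∑ i ∈ Finset.Icc 1 t, rate M s (x i)
          + α * Real.sqrt ((t + 1 : ℕ) : ℝ) * pert γ s) ∂gauss N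
        + (A + 2 * B) / (2 * Real.sqrt (2 * Real.pi) * α)
            * (1 / Real.sqrt ((t + 1 : ℕ) : ℝ)) := by
    intro t
    have hη : 0 < α * Real.sqrt ((t + 1 : ℕ) : ℝ) := by positivity
    refine (integral_leader_loss_le (S := configs N M)
      (L := fun s => ∑ i ∈ Finset.Icc 1 t, rate M s (x i))
      (ℓ := fun s => rate M s (x (t + 1))) (κ := fun s => codedRate M s (x (t + 1)))
      (y := trunc (x (t + 1))) (C := rmaxC N K M)
      (fun s hs => eq_zero_or_one_of_mem_configs hs) (trunc_nonneg _)
      (fun s hs => codedRate_nonneg hM hs _) (fun s hs => codedRate_le_rmaxC hs (hx _))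
      (fun s => rfl) (fun s hs s' hs' => rate_sub_rate_le hM hs hs' (hx _)) hη
      (hmeas (t + 1)) (hmem (t + 1)) fun γ s hs => ?_).trans ?_
    · have h := hmin (t + 1) γ s hs
      rw [obj_eq hN hM, obj_eq hN hM] at h
      exact sub_le_sub_iff_right _ |>.1 h
    · gcongr
      rw [div_mul_div_comm, mul_one, ← mul_assoc]
      gcongr
      exact stability_constant_le hN hK hM hMN
        (Finset.sum_nonneg fun j _ => trunc_nonneg _ j) (sum_trunc_le_card _)
        (sum_trunc_le_of_mem_requests (hx _)) rfl
  have hsum := sum_loss_le ⟨_, one_mem_configs hMN⟩ (η := fun t : ℕ => α * Real.sqrt t)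
    (e := fun t => ∫ γ, rate M (σ t γ) (x t) ∂gauss N)
    (D := fun t : ℕ => (A + 2 * B) / (2 * Real.sqrt (2 * Real.pi) * α) * (1 / Real.sqrt t))
    (loss := fun i s => rate M s (x i))
    (fun a b hab => by dsimp only; gcongr) (by simp) hstep T
  have hbest : ∫ γ, minOver (configs N M) (fun s => ∑ i ∈ Finset.Icc 1 T, rate M s (x i)
        + α * Real.sqrt T * pert γ s) ∂gauss N
      ≤ sInf {r : ℝ | ∃ s ∈ configs N M, r = ∑ t ∈ Finset.Icc 1 T, rate M s (x t)} := by
    refine le_csInf ⟨_, _, one_mem_configs hMN, rfl⟩ ?_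
    rintro r ⟨s, hs, rfl⟩
    exact integral_minOver_pert_le (fun s => ∑ i ∈ Finset.Icc 1 T, rate M s (x i)) _ hs
  have hg := gmax_eq hMN
  rw [← Finset.mul_sum] at hsum
  have hsplit : (A + 2 * B) / (2 * Real.sqrt (2 * Real.pi) * α)
      = A / (2 * Real.sqrt (2 * Real.pi) * α) + B / (Real.sqrt (2 * Real.pi) * α) := by
    field_simp
  rw [hsplit, add_mul] at hsum
  rw [regret, hg]
  linarith

theorem sum_one_div_sqrt_le (T : ℕ) :
    ∑ t ∈ Finset.Icc 1 T, 1 / Real.sqrt t ≤ 2 * Real.sqrt T := by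
  induction T with
  | zero => simp
  | succ T ih =>
    rw [Finset.sum_Icc_succ_top (Nat.le_add_left 1 T)]
    have ha := Real.sqrt_nonneg (T : ℝ)
    have hb : 0 < Real.sqrt ((T + 1 : ℕ) : ℝ) := by positivity
    have ha2 := Real.sq_sqrt (Nat.cast_nonneg (α := ℝ) T)
    have hb2 := Real.sq_sqrt (Nat.cast_nonneg (α := ℝ) (T + 1))
    have : 1 / Real.sqrt ((T + 1 : ℕ) : ℝ)
        ≤ 2 * Real.sqrt ((T + 1 : ℕ) : ℝ) - 2 * Real.sqrt T := by
      rw [div_le_iff₀ hb]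
      push_cast at *
      nlinarith [sq_nonneg (Real.sqrt ((T : ℝ) + 1) - Real.sqrt T)]
    linarith

end Model

/-- Theorem 1: for any horizon `T ≥ 1` and any request sequence, the regret of the
FTPL coded caching policy with learning rates `η_t = α√t` is bounded by
`(3·r_max·r_max^C·(|S|−1)/(2√(2π)α))·∑_{t=1}^T 1/√t + α√T·G_max
  + (K²·max{M/N, 1−M/N}/(√(2π)α))·∑_{t=1}^T 1/√t + α·G_max + r_max^C`;
consequently the adversarial regret (supremum over request sequences) is `O(√T)`. -/
theorem ftpl_regret_unrestricted (N K M : ℕ)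
    (hN : 0 < N) (hK : 0 < K) (hM : 0 < M) (hMN : M ≤ N) (α : ℝ) (hα : 0 < α) :
    (∀ x : ℕ → Fin N → ℕ, (∀ t, x t ∈ requests N K) →
      ∀ σ : ℕ → (Fin N → ℝ) → Fin N → ℕ,
        IsFTPL M (fun t => α * Real.sqrt t) x σ →
      ∀ T : ℕ, 1 ≤ T →
        regret M x σ T ≤
          3 * rmax N K M * rmaxC N K M * (((configs N M).card : ℝ) - 1)
              / (2 * Real.sqrt (2 * Real.pi) * α)
              * (∑ t ∈ Finset.Icc 1 T, 1 / Real.sqrt t)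
            + α * Real.sqrt T * gmax N M
            + (K : ℝ) ^ 2 * max ((M : ℝ) / N) (1 - (M : ℝ) / N)
              / (Real.sqrt (2 * Real.pi) * α)
              * (∑ t ∈ Finset.Icc 1 T, 1 / Real.sqrt t)
            + α * gmax N M + rmaxC N K M)
    ∧ ∃ C : ℝ, ∀ x : ℕ → Fin N → ℕ, (∀ t, x t ∈ requests N K) →
        ∀ σ : ℕ → (Fin N → ℝ) → Fin N → ℕ,
          IsFTPL M (fun t => α * Real.sqrt t) x σ →
        ∀ T : ℕ, 1 ≤ T → regret M x σ T ≤ C * Real.sqrt T := by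
  have hC := rmaxC_nonneg (K := K) hN hM hMN
  have hr := rmax_nonneg (K := K) hN hM hMN
  have hG := gmax_nonneg hMN
  have hcard : (1 : ℝ) ≤ (configs N M).card := by
    exact_mod_cast Finset.card_pos.2 ⟨_, one_mem_configs hMN⟩
  refine ⟨fun x hx σ hσ T _ => ?_, ?_⟩
  · have h := regret_le hN hK hM hMN hα hx hσ T
    have := mul_nonneg hα.le hG
    linarith
  · refine ⟨3 * rmax N K M * rmaxC N K M * (((configs N M).card : ℝ) - 1)
        / (2 * Real.sqrt (2 * Real.pi) * α) * 2 + α * gmax N M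
        + (K : ℝ) ^ 2 * max ((M : ℝ) / N) (1 - (M : ℝ) / N)
        / (Real.sqrt (2 * Real.pi) * α) * 2, fun x hx σ hσ T _ => ?_⟩
    refine (regret_le hN hK hM hMN hα hx hσ T).trans ?_
    have hsum := sum_one_div_sqrt_le T
    have hA : 0 ≤ 3 * rmax N K M * rmaxC N K M * (((configs N M).card : ℝ) - 1)
        / (2 * Real.sqrt (2 * Real.pi) * α) := by
      have := sub_nonneg.2 hcard
      positivity
    have hB : 0 ≤ (K : ℝ) ^ 2 * max ((M : ℝ) / N) (1 - (M : ℝ) / N)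
        / (Real.sqrt (2 * Real.pi) * α) := by positivity
    linarith [mul_le_mul_of_nonneg_left hsum hA, mul_le_mul_of_nonneg_left hsum hB]

end CodedCaching
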